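/- arXiv:2405.16703 — 3 statements merged into one kernel-verified Lean document; each statement's English description precedes it below -/
import Mathlib

section
/- Let V₁, V₂ be complex vector spaces with sl₂-actions, and let v₁ ∈ V₁, v₂ ∈ V₂ be primitive vectors of weights m₁ and m₂ (nonnegative integers). For every integer l with 0 ≤ l ≤ min(m₁,m₂), the vector ⟨v₁,v₂⟩_l = Σ_{p=0}^{l} (−1)^p/((m₁)_p (m₂)_{l−p}) · (f^p v₁)/p! ⊗ (f^{l−p} v₂)/(l−p)! is a singular vector of weight m₁+m₂−2l for the diagonal action: (e₁⊗1 + 1⊗e₂)⟨v₁,v₂⟩_l = 0 and (h₁⊗1 + 1⊗h₂)⟨v₁,v₂⟩_l = (m₁+m₂−2l)·⟨v₁,v₂⟩_l. -/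
open scoped TensorProduct

/-- An sl₂-action on a complex vector space `V`. -/
def IsSl2Action {V : Type*} [AddCommGroup V] [Module ℂ V]
    (e f h : Module.End ℂ V) : Prop :=
  h ∘ₗ e - e ∘ₗ h = (2 : ℂ) • e ∧ h ∘ₗ f - f ∘ₗ h = (-2 : ℂ) • f ∧ e ∘ₗ f - f ∘ₗ e = h

/-- The falling factorial `(x)_n = x(x−1)⋯(x−n+1)`, with `(x)_0 = 1`. -/
noncomputable def fallFac (x : ℂ) (n : ℕ) : ℂ := ∏ i ∈ Finset.range n, (x - i)

/-- The vector `⟨v₁,v₂⟩_l = Σ_{p=0}^{l} (−1)^p/((m₁)_p (m₂)_{l−p}) · (fᵖv₁)/p! ⊗ (f^{l−p}v₂)/(l−p)!`. -/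
noncomputable def singVec {V₁ V₂ : Type*} [AddCommGroup V₁] [Module ℂ V₁]
    [AddCommGroup V₂] [Module ℂ V₂]
    (f₁ : Module.End ℂ V₁) (f₂ : Module.End ℂ V₂) (v₁ : V₁) (v₂ : V₂)
    (m₁ m₂ l : ℕ) : V₁ ⊗[ℂ] V₂ :=
  ∑ p ∈ Finset.range (l + 1),
    ((-1 : ℂ) ^ p /
        (fallFac (m₁ : ℂ) p * fallFac (m₂ : ℂ) (l - p) *
          (Nat.factorial p : ℂ) * (Nat.factorial (l - p) : ℂ))) •
      (((f₁ ^ p) v₁) ⊗ₜ[ℂ] ((f₂ ^ (l - p)) v₂))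

theorem fallFac_succ (x : ℂ) (n : ℕ) : fallFac x (n + 1) = fallFac x n * (x - n) :=
  Finset.prod_range_succ _ _

theorem fallFac_natCast_ne_zero {m n : ℕ} (hn : n ≤ m) : fallFac (m : ℂ) n ≠ 0 := by
  refine Finset.prod_ne_zero_iff.2 fun i hi => sub_ne_zero.2 ?_
  have := Finset.mem_range.1 hi
  exact_mod_cast (by omega : m ≠ i)

section

variable {V : Type*} [AddCommGroup V] [Module ℂ V] {e f h : Module.End ℂ V} {v : V} {m : ℕ}

/-- The normalized descendant `fᵖ v / ((m)_p p!)` of a primitive vector of weight `m`. -/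
noncomputable def normDesc (f : Module.End ℂ V) (v : V) (m p : ℕ) : V :=
  (fallFac (m : ℂ) p * (Nat.factorial p : ℂ))⁻¹ • (f ^ p) v

theorem IsSl2Action.h_pow_f (hsl : IsSl2Action e f h) (hvh : h v = (m : ℂ) • v) (p : ℕ) :
    h ((f ^ p) v) = ((m : ℂ) - 2 * p) • (f ^ p) v := by
  induction p with
  | zero => simpa using hvh
  | succ p ih =>
    have key := LinearMap.congr_fun hsl.2.1 ((f ^ p) v)
    simp only [LinearMap.sub_apply, LinearMap.comp_apply, LinearMap.smul_apply, ih, map_smul,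
      sub_eq_iff_eq_add] at key
    rw [pow_succ', Module.End.mul_apply, key]
    push_cast
    module

theorem IsSl2Action.e_pow_f_succ (hsl : IsSl2Action e f h) (hve : e v = 0)
    (hvh : h v = (m : ℂ) • v) (p : ℕ) :
    e ((f ^ (p + 1)) v) = (((p : ℂ) + 1) * ((m : ℂ) - p)) • (f ^ p) v := by
  induction p with
  | zero =>
    have key := LinearMap.congr_fun hsl.2.2 v
    simp only [LinearMap.sub_apply, LinearMap.comp_apply, hve, map_zero, sub_zero] at key
    simpa [key] using hvh
  | succ p ih =>
    have key := LinearMap.congr_fun hsl.2.2 ((f ^ (p + 1)) v)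
    simp only [LinearMap.sub_apply, LinearMap.comp_apply, ih, hsl.h_pow_f hvh, map_smul,
      sub_eq_iff_eq_add] at key
    rw [pow_succ', Module.End.mul_apply, key, pow_succ', Module.End.mul_apply]
    push_cast
    module

theorem IsSl2Action.h_normDesc (hsl : IsSl2Action e f h) (hvh : h v = (m : ℂ) • v) (p : ℕ) :
    h (normDesc f v m p) = ((m : ℂ) - 2 * p) • normDesc f v m p := by
  rw [normDesc, map_smul, hsl.h_pow_f hvh, smul_comm]

theorem e_normDesc_zero (hve : e v = 0) : e (normDesc f v m 0) = 0 := by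
  simp [normDesc, hve]

theorem IsSl2Action.e_normDesc_succ (hsl : IsSl2Action e f h) (hve : e v = 0)
    (hvh : h v = (m : ℂ) • v) {p : ℕ} (hp : p < m) :
    e (normDesc f v m (p + 1)) = normDesc f v m p := by
  have h1 : (m : ℂ) - p ≠ 0 := sub_ne_zero.2 (by exact_mod_cast hp.ne')
  have h2 := fallFac_natCast_ne_zero hp.le
  have h3 : (Nat.factorial p : ℂ) ≠ 0 := by exact_mod_cast p.factorial_ne_zero
  have h4 : (p : ℂ) + 1 ≠ 0 := by exact_mod_cast p.succ_ne_zero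
  rw [normDesc, normDesc, map_smul, hsl.e_pow_f_succ hve hvh, smul_smul, fallFac_succ,
    Nat.factorial_succ]
  congr 1
  push_cast
  field_simp

end

theorem singVec_eq_sum_normDesc {V₁ V₂ : Type*} [AddCommGroup V₁] [Module ℂ V₁]
    [AddCommGroup V₂] [Module ℂ V₂] (f₁ : Module.End ℂ V₁) (f₂ : Module.End ℂ V₂)
    (v₁ : V₁) (v₂ : V₂) (m₁ m₂ l : ℕ) :
    singVec f₁ f₂ v₁ v₂ m₁ m₂ l = ∑ p ∈ Finset.range (l + 1),
      (-1 : ℂ) ^ p • (normDesc f₁ v₁ m₁ p ⊗ₜ[ℂ] normDesc f₂ v₂ m₂ (l - p)) := by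
  refine Finset.sum_congr rfl fun p _ => ?_
  rw [normDesc, normDesc, TensorProduct.smul_tmul_smul, smul_smul, ← mul_inv, div_eq_mul_inv]
  congr 3
  ring

/-- `⟨v₁,v₂⟩_l` is a singular vector of weight `m₁ + m₂ − 2l` for the diagonal action. -/
theorem singVec_is_singular
    {V₁ V₂ : Type*} [AddCommGroup V₁] [Module ℂ V₁] [AddCommGroup V₂] [Module ℂ V₂]
    (e₁ f₁ h₁ : Module.End ℂ V₁) (e₂ f₂ h₂ : Module.End ℂ V₂)
    (hsl1 : IsSl2Action e₁ f₁ h₁) (hsl2 : IsSl2Action e₂ f₂ h₂)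
    (m₁ m₂ : ℕ) (v₁ : V₁) (v₂ : V₂)
    (hv₁e : e₁ v₁ = 0) (hv₁h : h₁ v₁ = (m₁ : ℂ) • v₁)
    (hv₂e : e₂ v₂ = 0) (hv₂h : h₂ v₂ = (m₂ : ℂ) • v₂)
    (l : ℕ) (hl : l ≤ min m₁ m₂) :
    (LinearMap.rTensor V₂ e₁ + LinearMap.lTensor V₁ e₂) (singVec f₁ f₂ v₁ v₂ m₁ m₂ l) = 0 ∧
    (LinearMap.rTensor V₂ h₁ + LinearMap.lTensor V₁ h₂) (singVec f₁ f₂ v₁ v₂ m₁ m₂ l) =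
      ((m₁ : ℂ) + (m₂ : ℂ) - 2 * (l : ℂ)) • singVec f₁ f₂ v₁ v₂ m₁ m₂ l := by
  obtain ⟨hl₁, hl₂⟩ := le_min_iff.1 hl
  rw [singVec_eq_sum_normDesc]
  constructor
  · simp only [LinearMap.add_apply, map_sum, map_smul, LinearMap.rTensor_tmul,
      LinearMap.lTensor_tmul, smul_add, Finset.sum_add_distrib]
    rw [Finset.sum_range_succ', Finset.sum_range_succ (n := l), Nat.sub_self,
      e_normDesc_zero hv₁e, e_normDesc_zero hv₂e, TensorProduct.zero_tmul,
      TensorProduct.tmul_zero, smul_zero, smul_zero, add_zero, add_zero,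
      ← Finset.sum_add_distrib]
    refine Finset.sum_eq_zero fun p hp => ?_
    have hpl := Finset.mem_range.1 hp
    obtain ⟨q, rfl⟩ := Nat.exists_eq_add_of_lt hpl
    rw [show p + q + 1 - (p + 1) = q by omega, show p + q + 1 - p = q + 1 by omega,
      hsl1.e_normDesc_succ hv₁e hv₁h (by omega), hsl2.e_normDesc_succ hv₂e hv₂h (by omega),
      pow_succ]
    module
  · rw [map_sum, Finset.smul_sum]
    refine Finset.sum_congr rfl fun p hp => ?_
    have hpl : p ≤ l := Nat.lt_succ_iff.1 (Finset.mem_range.1 hp)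
    rw [map_smul, LinearMap.add_apply, LinearMap.rTensor_tmul, LinearMap.lTensor_tmul,
      hsl1.h_normDesc hv₁h, hsl2.h_normDesc hv₂h, ← TensorProduct.smul_tmul',
      TensorProduct.tmul_smul, Nat.cast_sub hpl]
    module
end

section
/- Let V₁, V₂ be complex vector spaces with sl₂-actions, v₁ ∈ V₁, v₂ ∈ V₂ primitive of weights m₁, m₂ (nonnegative integers), and S₁, S₂ contravariant symmetric bilinear forms with S₁(v₁,v₁) = S₂(v₂,v₂) = 1; let S = S₁⊗S₂ on V₁⊗V₂. Then for every integer 0 ≤ l ≤ min(m₁,m₂): S(⟨v₁,v₂⟩_l, ⟨v₁,v₂⟩_l) = C(m₁+m₂−l+1, l) / ((m₁)_l (m₂)_l), where C(n,k) is the binomial coefficient. -/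
open scoped TensorProduct

/-- Lowering and then raising in the module generated by a primitive vector of weight `m`. -/
theorem e_f_pow_succ {V : Type*} [AddCommGroup V] [Module ℂ V] {e f h : Module.End ℂ V}
    (hsl : IsSl2Action e f h) {m : ℂ} {v : V} (he : e v = 0) (hh : h v = m • v) (n : ℕ) :
    h ((f ^ n) v) = (m - 2 * n) • (f ^ n) v ∧
      e ((f ^ (n + 1)) v) = ((n + 1) * (m - n)) • (f ^ n) v := by
  obtain ⟨-, h2, h3⟩ := hsl
  have hf (x : V) : h (f x) = f (h x) - (2 : ℂ) • f x := by
    have := LinearMap.congr_fun h2 x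
    simp only [LinearMap.sub_apply, LinearMap.comp_apply, LinearMap.smul_apply] at this
    rw [sub_eq_iff_eq_add] at this
    rw [this]
    module
  have ef (x : V) : e (f x) = f (e x) + h x := by
    have := LinearMap.congr_fun h3 x
    simp only [LinearMap.sub_apply, LinearMap.comp_apply] at this
    rw [← this]
    abel
  induction n with
  | zero => simp [ef, he, hh]
  | succ n ih =>
    obtain ⟨ih1, ih2⟩ := ih
    have key : h ((f ^ (n + 1)) v) = (m - 2 * (n + 1 : ℕ)) • (f ^ (n + 1)) v := by
      rw [pow_succ', Module.End.mul_apply, hf, ih1, map_smul]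
      push_cast
      module
    refine ⟨key, ?_⟩
    rw [pow_succ' f (n + 1), Module.End.mul_apply, ef, ih2, key, map_smul,
      ← Module.End.mul_apply f, ← pow_succ']
    push_cast
    module

theorem fallFac_natCast (m n : ℕ) : fallFac m n = (m.descFactorial n : ℂ) := by
  induction n with
  | zero => simp [fallFac]
  | succ n ih =>
    rw [fallFac_succ, ih, Nat.descFactorial_succ]
    rcases le_or_gt n m with h | h
    · push_cast [Nat.cast_sub h]
      ring
    · simp [Nat.descFactorial_of_lt h]

/-- The vectors `fᵖ v` are orthogonal for a contravariant form, with `S(fᵖ v, fᵖ v) = p! (m)_p`. -/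
theorem contravariant_f_pow {V : Type*} [AddCommGroup V] [Module ℂ V] {e f h : Module.End ℂ V}
    (hsl : IsSl2Action e f h) {m : ℂ} {v : V} (he : e v = 0) (hh : h v = m • v)
    (S : V →ₗ[ℂ] V →ₗ[ℂ] ℂ) (hsymm : ∀ x y, S x y = S y x)
    (hcontra : ∀ x y, S (e x) y = S x (f y)) (hv : S v v = 1) (p q : ℕ) :
    S ((f ^ p) v) ((f ^ q) v) = if p = q then (p.factorial : ℂ) * fallFac m p else 0 := by
  have h0 (q : ℕ) : S v ((f ^ (q + 1)) v) = 0 := by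
    rw [pow_succ', Module.End.mul_apply, ← hcontra, he, map_zero, LinearMap.zero_apply]
  induction p generalizing q with
  | zero =>
    cases q with
    | zero => simp [hv, fallFac]
    | succ q => simpa using h0 q
  | succ p ih =>
    cases q with
    | zero => simpa using (hsymm _ _).trans (h0 p)
    | succ q =>
      rw [pow_succ' f q, Module.End.mul_apply, ← hcontra, (e_f_pow_succ hsl he hh p).2, map_smul,
        LinearMap.smul_apply, ih, fallFac_succ, Nat.factorial_succ]
      by_cases hpq : p = q
      · simp only [hpq, if_true, smul_eq_mul]
        push_cast
        ring
      · simp [hpq]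

/-- The Chu–Vandermonde identity with negative upper arguments. -/
theorem sum_choose_add_mul_choose_add (a b l : ℕ) :
    ∑ p ∈ Finset.range (l + 1), (a + (l - p)).choose (l - p) * (b + p).choose p =
      (a + b + l + 1).choose l := by
  have key := congrArg (fun u : (PowerSeries ℤ)ˣ => PowerSeries.coeff l u.val)
    (PowerSeries.invOneSubPow_add (S := ℤ) (b + 1) (a + 1))
  rw [show b + 1 + (a + 1) = (a + b + 1) + 1 by ring] at key
  simp only [Units.val_mul, PowerSeries.invOneSubPow_val_succ_eq_mk_add_choose,
    PowerSeries.coeff_mul, PowerSeries.coeff_mk,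
    Finset.Nat.sum_antidiagonal_eq_sum_range_succ_mk] at key
  rw [add_right_comm (a + b) l 1, ← Nat.choose_symm_add]
  zify
  rw [key]
  refine Finset.sum_congr rfl fun p _ => ?_
  rw [← Nat.choose_symm_add, ← Nat.choose_symm_add, mul_comm]

theorem descFactorial_eq_mul_choose {m l p : ℕ} (hp : p ≤ l) (hl : l ≤ m) :
    m.descFactorial l =
      m.descFactorial p * ((l - p).factorial * (m - l + (l - p)).choose (l - p)) := by
  rw [← Nat.descFactorial_eq_factorial_mul_choose, mul_comm]
  have := Nat.descFactorial_mul_descFactorial (n := m) hp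
  rw [← this]
  congr 2
  omega

/-- The Shapovalov norm of the singular vector `⟨v₁,v₂⟩_l`:
`S(⟨v₁,v₂⟩_l, ⟨v₁,v₂⟩_l) = C(m₁+m₂−l+1, l) / ((m₁)_l (m₂)_l)`. -/
theorem singVec_shapovalov_norm
    {V₁ V₂ : Type*} [AddCommGroup V₁] [Module ℂ V₁] [AddCommGroup V₂] [Module ℂ V₂]
    (e₁ f₁ h₁ : Module.End ℂ V₁) (e₂ f₂ h₂ : Module.End ℂ V₂)
    (hsl1 : IsSl2Action e₁ f₁ h₁) (hsl2 : IsSl2Action e₂ f₂ h₂)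
    (m₁ m₂ : ℕ) (v₁ : V₁) (v₂ : V₂)
    (hv₁e : e₁ v₁ = 0) (hv₁h : h₁ v₁ = (m₁ : ℂ) • v₁)
    (hv₂e : e₂ v₂ = 0) (hv₂h : h₂ v₂ = (m₂ : ℂ) • v₂)
    (S₁ : V₁ →ₗ[ℂ] V₁ →ₗ[ℂ] ℂ) (S₂ : V₂ →ₗ[ℂ] V₂ →ₗ[ℂ] ℂ)
    (hsymm₁ : ∀ x y : V₁, S₁ x y = S₁ y x) (hsymm₂ : ∀ x y : V₂, S₂ x y = S₂ y x)
    (hcontra₁ : ∀ x y : V₁, S₁ (e₁ x) y = S₁ x (f₁ y))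
    (hcontra₂ : ∀ x y : V₂, S₂ (e₂ x) y = S₂ x (f₂ y))
    (hS₁v : S₁ v₁ v₁ = 1) (hS₂v : S₂ v₂ v₂ = 1)
    (S : (V₁ ⊗[ℂ] V₂) →ₗ[ℂ] (V₁ ⊗[ℂ] V₂) →ₗ[ℂ] ℂ)
    (hS : ∀ (a c : V₁) (b d : V₂), S (a ⊗ₜ[ℂ] b) (c ⊗ₜ[ℂ] d) = S₁ a c * S₂ b d)
    (l : ℕ) (hl : l ≤ min m₁ m₂) :
    S (singVec f₁ f₂ v₁ v₂ m₁ m₂ l) (singVec f₁ f₂ v₁ v₂ m₁ m₂ l) =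
      (Nat.choose (m₁ + m₂ + 1 - l) l : ℂ) / (fallFac (m₁ : ℂ) l * fallFac (m₂ : ℂ) l) := by
  obtain ⟨hl₁, hl₂⟩ := le_min_iff.mp hl
  have hd {m n : ℕ} (h : n ≤ m) : (m.descFactorial n : ℂ) ≠ 0 := by
    exact_mod_cast (Nat.descFactorial_pos.mpr h).ne'
  have hsum := sum_choose_add_mul_choose_add (m₁ - l) (m₂ - l) l
  rw [show m₁ - l + (m₂ - l) + l + 1 = m₁ + m₂ + 1 - l by omega] at hsum
  rw [← hsum, Nat.cast_sum, Finset.sum_div]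
  simp only [singVec, map_sum, map_smul, LinearMap.sum_apply, LinearMap.smul_apply, hS,
    contravariant_f_pow hsl1 hv₁e hv₁h S₁ hsymm₁ hcontra₁ hS₁v, smul_eq_mul, ite_mul, mul_ite,
    zero_mul, mul_zero]
  refine Finset.sum_congr rfl fun p hp => ?_
  rw [Finset.sum_ite_eq_of_mem' _ _ _ hp,
    contravariant_f_pow hsl2 hv₂e hv₂h S₂ hsymm₂ hcontra₂ hS₂v, if_pos rfl]
  have hpl : p ≤ l := Nat.lt_succ_iff.mp (Finset.mem_range.mp hp)
  have d₁ := descFactorial_eq_mul_choose hpl hl₁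
  have d₂ := descFactorial_eq_mul_choose (Nat.sub_le l p) hl₂
  rw [Nat.sub_sub_self hpl] at d₂
  have hp₁ := hd (hpl.trans hl₁)
  have hp₂ := hd ((Nat.sub_le l p).trans hl₂)
  have hf₁ : (p.factorial : ℂ) ≠ 0 := by exact_mod_cast p.factorial_ne_zero
  have hf₂ : ((l - p).factorial : ℂ) ≠ 0 := by exact_mod_cast (l - p).factorial_ne_zero
  have hc₁ : ((m₁ - l + (l - p)).choose (l - p) : ℂ) ≠ 0 := by
    exact_mod_cast (Nat.choose_pos (Nat.le_add_left _ _)).ne'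
  have hc₂ : ((m₂ - l + p).choose p : ℂ) ≠ 0 := by
    exact_mod_cast (Nat.choose_pos (Nat.le_add_left _ _)).ne'
  have hs : ((-1 : ℂ) ^ p) * (-1) ^ p = 1 := by rw [← mul_pow]; simp
  simp only [fallFac_natCast]
  rw [d₁, d₂]
  push_cast
  field_simp
  linear_combination hs
end

section
/- Let V₁, V₂, V₃ be complex vector spaces with sl₂-actions and v_i ∈ V_i primitive of weights m_i (nonnegative integers). Let r be a nonnegative integer and r₁ admissible. Then Ω₁₂ W_{r₁} = (r₁(r₁−m₁−m₂−1) + m₁m₂/2) · W_{r₁}, where Ω₁₂ = e⊗f + f⊗e + ½h⊗h acts on the first two tensor factors of V₁⊗V₂⊗V₃ and as the identity on V₃. -/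
open scoped TensorProduct

/-- `r₁` is admissible for `(m₁, m₂, m₃, r)` when
`max(0, r−m₃) ≤ r₁ ≤ min(r, min(m₁,m₂), m₁+m₂−r)`. -/
def Admissible (m₁ m₂ m₃ r : ℕ) (k : ℤ) : Prop :=
  (r : ℤ) - (m₃ : ℤ) ≤ k ∧ 0 ≤ k ∧ k ≤ (r : ℤ) ∧ k ≤ (m₁ : ℤ) ∧ k ≤ (m₂ : ℤ) ∧
    k ≤ (m₁ : ℤ) + (m₂ : ℤ) - (r : ℤ)

/-- The coefficient `C^{r₁}_{i,j}` from the Shapovalov basis formula. -/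
noncomputable def Ccoef (m₁ m₂ m₃ r r₁ i j : ℕ) : ℂ :=
  (1 / (fallFac (m₁ : ℂ) i * fallFac (m₂ : ℂ) (r₁ - i) *
      (Nat.factorial i : ℂ) * (Nat.factorial (r₁ - i) : ℂ))) *
  (1 / (fallFac ((m₁ : ℂ) + (m₂ : ℂ) - 2 * (r₁ : ℂ)) j * fallFac (m₃ : ℂ) (r - r₁ - j) *
      (Nat.factorial j : ℂ) * (Nat.factorial (r - r₁ - j) : ℂ)))

/-- The (unnormalized) Shapovalov basis vector
`W_{r₁} = Σᵢⱼ (−1)^{i+j} C^{r₁}_{i,j} · f^j(fⁱv₁ ⊗ f^{r₁−i}v₂) ⊗ f^{r−r₁−j}v₃`,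
where `f` acts diagonally on the first two tensor factors. -/
noncomputable def Wvec {V₁ V₂ V₃ : Type*} [AddCommGroup V₁] [Module ℂ V₁]
    [AddCommGroup V₂] [Module ℂ V₂] [AddCommGroup V₃] [Module ℂ V₃]
    (f₁ : Module.End ℂ V₁) (f₂ : Module.End ℂ V₂) (f₃ : Module.End ℂ V₃)
    (v₁ : V₁) (v₂ : V₂) (v₃ : V₃) (m₁ m₂ m₃ r r₁ : ℕ) : (V₁ ⊗[ℂ] V₂) ⊗[ℂ] V₃ :=
  ∑ i ∈ Finset.range (r₁ + 1), ∑ j ∈ Finset.range (r - r₁ + 1),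
    ((-1 : ℂ) ^ (i + j) * Ccoef m₁ m₂ m₃ r r₁ i j) •
      ((((LinearMap.rTensor V₂ f₁ + LinearMap.lTensor V₁ f₂ :
            Module.End ℂ (V₁ ⊗[ℂ] V₂)) ^ j)
          (((f₁ ^ i) v₁) ⊗ₜ[ℂ] ((f₂ ^ (r₁ - i)) v₂))) ⊗ₜ[ℂ] ((f₃ ^ (r - r₁ - j)) v₃))

/-- The operator `Ω₁₂ = e ⊗ f + f ⊗ e + ½ h ⊗ h` acting on the first two tensor factors
of `V₁ ⊗ V₂ ⊗ V₃` and as the identity on `V₃`. -/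
noncomputable def Omega12Triple {V₁ V₂ V₃ : Type*} [AddCommGroup V₁] [Module ℂ V₁]
    [AddCommGroup V₂] [Module ℂ V₂] [AddCommGroup V₃] [Module ℂ V₃]
    (e₁ f₁ h₁ : Module.End ℂ V₁) (e₂ f₂ h₂ : Module.End ℂ V₂) :
    Module.End ℂ ((V₁ ⊗[ℂ] V₂) ⊗[ℂ] V₃) :=
  LinearMap.rTensor V₃
    (TensorProduct.map e₁ f₂ + TensorProduct.map f₁ e₂ + (2⁻¹ : ℂ) • TensorProduct.map h₁ h₂)

namespace IsSl2Action

section Single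

variable {V : Type*} [AddCommGroup V] [Module ℂ V] {e f h : Module.End ℂ V}

theorem h_f_apply (hsl : IsSl2Action e f h) (x : V) : h (f x) = f (h x) - (2 : ℂ) • f x := by
  have := LinearMap.congr_fun hsl.2.1 x
  simp only [LinearMap.sub_apply, LinearMap.comp_apply, LinearMap.smul_apply] at this
  rw [sub_eq_iff_eq_add.mp this]
  module

theorem e_f_apply (hsl : IsSl2Action e f h) (x : V) : e (f x) = f (e x) + h x := by
  have := LinearMap.congr_fun hsl.2.2 x
  simp only [LinearMap.sub_apply, LinearMap.comp_apply] at this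
  rw [sub_eq_iff_eq_add.mp this, add_comm]

variable {v : V} {m : ℂ}

theorem h_f_pow_apply (hsl : IsSl2Action e f h) (hh : h v = m • v) (n : ℕ) :
    h ((f ^ n) v) = (m - 2 * n) • (f ^ n) v := by
  induction n with
  | zero => simp [hh]
  | succ n ih =>
    rw [pow_succ', Module.End.mul_apply, hsl.h_f_apply, ih, map_smul]
    push_cast
    module

theorem e_f_pow_succ_apply (hsl : IsSl2Action e f h) (he : e v = 0) (hh : h v = m • v) (n : ℕ) :
    e ((f ^ (n + 1)) v) = ((n + 1) * (m - n)) • (f ^ n) v := by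
  induction n with
  | zero => simp [hsl.e_f_apply, he, hh]
  | succ n ih =>
    rw [pow_succ', Module.End.mul_apply, hsl.e_f_apply, ih, map_smul, hsl.h_f_pow_apply hh,
      ← Module.End.mul_apply, ← pow_succ']
    push_cast
    module

theorem f_e_f_pow_apply (hsl : IsSl2Action e f h) (he : e v = 0) (hh : h v = m • v) (n : ℕ) :
    f (e ((f ^ n) v)) = (n * (m - n + 1)) • (f ^ n) v := by
  cases n with
  | zero => simp [he]
  | succ n =>
    rw [hsl.e_f_pow_succ_apply he hh, map_smul, ← Module.End.mul_apply, ← pow_succ']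
    push_cast
    module

end Single

end IsSl2Action

section Tensor

variable {V₁ V₂ : Type*} [AddCommGroup V₁] [Module ℂ V₁] [AddCommGroup V₂] [Module ℂ V₂]

/-- The diagonal action of a pair of endomorphisms on `V₁ ⊗ V₂`. -/
noncomputable def diagAction (a₁ : Module.End ℂ V₁) (a₂ : Module.End ℂ V₂) :
    Module.End ℂ (V₁ ⊗[ℂ] V₂) :=
  LinearMap.rTensor V₂ a₁ + LinearMap.lTensor V₁ a₂

theorem diagAction_tmul (a₁ : Module.End ℂ V₁) (a₂ : Module.End ℂ V₂) (x : V₁) (y : V₂) :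
    diagAction a₁ a₂ (x ⊗ₜ[ℂ] y) = a₁ x ⊗ₜ[ℂ] y + x ⊗ₜ[ℂ] a₂ y := by
  simp [diagAction]

/-- The operator `Ω = e ⊗ f + f ⊗ e + ½ h ⊗ h` on `V₁ ⊗ V₂`. -/
noncomputable def omegaTensor (e₁ f₁ h₁ : Module.End ℂ V₁) (e₂ f₂ h₂ : Module.End ℂ V₂) :
    Module.End ℂ (V₁ ⊗[ℂ] V₂) :=
  TensorProduct.map e₁ f₂ + TensorProduct.map f₁ e₂ + (2⁻¹ : ℂ) • TensorProduct.map h₁ h₂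

theorem omegaTensor_tmul (e₁ f₁ h₁ : Module.End ℂ V₁) (e₂ f₂ h₂ : Module.End ℂ V₂) (x : V₁) (y : V₂) :
    omegaTensor e₁ f₁ h₁ e₂ f₂ h₂ (x ⊗ₜ[ℂ] y) =
      e₁ x ⊗ₜ[ℂ] f₂ y + f₁ x ⊗ₜ[ℂ] e₂ y + (2⁻¹ : ℂ) • (h₁ x ⊗ₜ[ℂ] h₂ y) := by
  simp [omegaTensor]

variable {e₁ f₁ h₁ : Module.End ℂ V₁} {e₂ f₂ h₂ : Module.End ℂ V₂}

theorem commute_omegaTensor_diagAction (hsl1 : IsSl2Action e₁ f₁ h₁) (hsl2 : IsSl2Action e₂ f₂ h₂) :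
    Commute (omegaTensor e₁ f₁ h₁ e₂ f₂ h₂) (diagAction f₁ f₂) := by
  refine TensorProduct.ext' fun x y => ?_
  simp only [Module.End.mul_apply, diagAction_tmul, omegaTensor_tmul, map_add, map_smul,
    hsl1.h_f_apply, hsl1.e_f_apply, hsl2.h_f_apply, hsl2.e_f_apply, TensorProduct.add_tmul,
    TensorProduct.tmul_add, TensorProduct.sub_tmul, TensorProduct.tmul_sub,
    TensorProduct.smul_tmul', TensorProduct.tmul_smul]
  simp only [← TensorProduct.smul_tmul']
  module

variable {v₁ : V₁} {v₂ : V₂}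

/-- The scalar does not depend on how `k` is split as `i + n`. -/
theorem omegaTensor_f_pow_tmul_f_pow (hsl1 : IsSl2Action e₁ f₁ h₁) (hsl2 : IsSl2Action e₂ f₂ h₂)
    {m₁ m₂ : ℂ} (he₁ : e₁ v₁ = 0) (hh₁ : h₁ v₁ = m₁ • v₁) (he₂ : e₂ v₂ = 0)
    (hh₂ : h₂ v₂ = m₂ • v₂) {i n k : ℕ} (hk : i + n = k) :
    omegaTensor e₁ f₁ h₁ e₂ f₂ h₂ ((f₁ ^ i) v₁ ⊗ₜ[ℂ] (f₂ ^ n) v₂) =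
      diagAction f₁ f₂ (diagAction e₁ e₂ ((f₁ ^ i) v₁ ⊗ₜ[ℂ] (f₂ ^ n) v₂)) +
        (k * (k - m₁ - m₂ - 1) + m₁ * m₂ / 2) • ((f₁ ^ i) v₁ ⊗ₜ[ℂ] (f₂ ^ n) v₂) := by
  subst hk
  simp only [diagAction_tmul, omegaTensor_tmul, map_add, hsl1.f_e_f_pow_apply he₁ hh₁,
    hsl2.f_e_f_pow_apply he₂ hh₂, hsl1.h_f_pow_apply hh₁, hsl2.h_f_pow_apply hh₂,
    TensorProduct.tmul_smul, ← TensorProduct.smul_tmul']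
  push_cast
  module

/-- The primitive vector of depth `k` generated by `v₁` and `v₂` in `V₁ ⊗ V₂`. -/
noncomputable def primVec (f₁ : Module.End ℂ V₁) (f₂ : Module.End ℂ V₂) (v₁ : V₁) (v₂ : V₂)
    (m₁ m₂ k : ℕ) : V₁ ⊗[ℂ] V₂ :=
  ∑ i ∈ Finset.range (k + 1),
    ((-1 : ℂ) ^ i * (1 / (fallFac (m₁ : ℂ) i * fallFac (m₂ : ℂ) (k - i) *
      (Nat.factorial i : ℂ) * (Nat.factorial (k - i) : ℂ)))) •
        ((f₁ ^ i) v₁ ⊗ₜ[ℂ] (f₂ ^ (k - i)) v₂)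

variable {m₁ m₂ : ℕ}

theorem diagAction_e_primVec (hsl1 : IsSl2Action e₁ f₁ h₁) (hsl2 : IsSl2Action e₂ f₂ h₂)
    (he₁ : e₁ v₁ = 0) (hh₁ : h₁ v₁ = (m₁ : ℂ) • v₁) (he₂ : e₂ v₂ = 0)
    (hh₂ : h₂ v₂ = (m₂ : ℂ) • v₂) {k : ℕ} (hk₁ : k ≤ m₁) (hk₂ : k ≤ m₂) :
    diagAction e₁ e₂ (primVec f₁ f₂ v₁ v₂ m₁ m₂ k) = 0 := by
  simp only [primVec, map_sum, map_smul, diagAction_tmul, smul_add, Finset.sum_add_distrib]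
  rw [Finset.sum_range_succ', Finset.sum_range_succ]
  simp only [pow_zero, Module.End.one_apply, he₁, he₂, Nat.sub_self, TensorProduct.zero_tmul,
    TensorProduct.tmul_zero, smul_zero, add_zero]
  rw [← Finset.sum_add_distrib]
  refine Finset.sum_eq_zero fun i hi => ?_
  obtain ⟨n, rfl⟩ := Nat.exists_eq_add_of_lt (Finset.mem_range.mp hi)
  rw [show i + n + 1 - (i + 1) = n by omega, show i + n + 1 - i = n + 1 by omega,
    hsl1.e_f_pow_succ_apply he₁ hh₁, hsl2.e_f_pow_succ_apply he₂ hh₂, TensorProduct.tmul_smul,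
    ← TensorProduct.smul_tmul', smul_smul, smul_smul, ← add_smul]
  convert zero_smul ℂ _
  have a1 := fallFac_natCast_ne_zero (m := m₁) (n := i + 1) (by omega)
  have a2 := fallFac_natCast_ne_zero (m := m₂) (n := n + 1) (by omega)
  rw [fallFac_succ] at a1 a2
  obtain ⟨b1, c1⟩ := mul_ne_zero_iff.mp a1
  obtain ⟨b2, c2⟩ := mul_ne_zero_iff.mp a2
  have d1 : (Nat.factorial i : ℂ) ≠ 0 := mod_cast Nat.factorial_ne_zero i
  have d2 : (Nat.factorial n : ℂ) ≠ 0 := mod_cast Nat.factorial_ne_zero n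
  have g1 : (i : ℂ) + 1 ≠ 0 := Nat.cast_add_one_ne_zero i
  have g2 : (n : ℂ) + 1 ≠ 0 := Nat.cast_add_one_ne_zero n
  rw [fallFac_succ, fallFac_succ, Nat.factorial_succ, Nat.factorial_succ, pow_succ]
  push_cast
  field_simp
  ring

theorem omegaTensor_primVec (hsl1 : IsSl2Action e₁ f₁ h₁) (hsl2 : IsSl2Action e₂ f₂ h₂)
    (he₁ : e₁ v₁ = 0) (hh₁ : h₁ v₁ = (m₁ : ℂ) • v₁) (he₂ : e₂ v₂ = 0)
    (hh₂ : h₂ v₂ = (m₂ : ℂ) • v₂) {k : ℕ} (hk₁ : k ≤ m₁) (hk₂ : k ≤ m₂) :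
    omegaTensor e₁ f₁ h₁ e₂ f₂ h₂ (primVec f₁ f₂ v₁ v₂ m₁ m₂ k) =
      ((k : ℂ) * (k - m₁ - m₂ - 1) + m₁ * m₂ / 2) • primVec f₁ f₂ v₁ v₂ m₁ m₂ k := by
  suffices omegaTensor e₁ f₁ h₁ e₂ f₂ h₂ (primVec f₁ f₂ v₁ v₂ m₁ m₂ k) =
      diagAction f₁ f₂ (diagAction e₁ e₂ (primVec f₁ f₂ v₁ v₂ m₁ m₂ k)) +
      ((k : ℂ) * (k - m₁ - m₂ - 1) + m₁ * m₂ / 2) • primVec f₁ f₂ v₁ v₂ m₁ m₂ k by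
    rw [this, diagAction_e_primVec hsl1 hsl2 he₁ hh₁ he₂ hh₂ hk₁ hk₂, map_zero, zero_add]
  simp only [primVec, map_sum, map_smul, Finset.smul_sum]
  rw [← Finset.sum_add_distrib]
  refine Finset.sum_congr rfl fun i hi => ?_
  rw [omegaTensor_f_pow_tmul_f_pow hsl1 hsl2 he₁ hh₁ he₂ hh₂
    (Nat.add_sub_of_le (Finset.mem_range_succ_iff.mp hi)), smul_add, smul_comm]

theorem Wvec_eq_sum_primVec {V₃ : Type*} [AddCommGroup V₃] [Module ℂ V₃]
    (f₁ : Module.End ℂ V₁) (f₂ : Module.End ℂ V₂) (f₃ : Module.End ℂ V₃)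
    (v₁ : V₁) (v₂ : V₂) (v₃ : V₃) (m₁ m₂ m₃ r r₁ : ℕ) :
    Wvec f₁ f₂ f₃ v₁ v₂ v₃ m₁ m₂ m₃ r r₁ =
      ∑ j ∈ Finset.range (r - r₁ + 1),
        ((-1 : ℂ) ^ j * (1 / (fallFac ((m₁ : ℂ) + (m₂ : ℂ) - 2 * (r₁ : ℂ)) j *
          fallFac (m₃ : ℂ) (r - r₁ - j) * (Nat.factorial j : ℂ) *
            (Nat.factorial (r - r₁ - j) : ℂ)))) •
          ((diagAction f₁ f₂ ^ j) (primVec f₁ f₂ v₁ v₂ m₁ m₂ r₁) ⊗ₜ[ℂ]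
            (f₃ ^ (r - r₁ - j)) v₃) := by
  rw [Wvec, Finset.sum_comm]
  refine Finset.sum_congr rfl fun j _ => ?_
  rw [primVec, map_sum, TensorProduct.sum_tmul, Finset.smul_sum]
  refine Finset.sum_congr rfl fun i _ => ?_
  rw [map_smul, ← TensorProduct.smul_tmul', smul_smul, Ccoef, pow_add]
  congr 1
  ring

end Tensor

/-- `W_{r₁}` is an eigenvector of `Ω₁₂` with eigenvalue `r₁(r₁−m₁−m₂−1) + m₁m₂/2`. -/
theorem omega12_eigenvector_Wvec
    {V₁ V₂ V₃ : Type*} [AddCommGroup V₁] [Module ℂ V₁]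
    [AddCommGroup V₂] [Module ℂ V₂] [AddCommGroup V₃] [Module ℂ V₃]
    (e₁ f₁ h₁ : Module.End ℂ V₁) (e₂ f₂ h₂ : Module.End ℂ V₂) (e₃ f₃ h₃ : Module.End ℂ V₃)
    (hsl1 : IsSl2Action e₁ f₁ h₁) (hsl2 : IsSl2Action e₂ f₂ h₂) (hsl3 : IsSl2Action e₃ f₃ h₃)
    (m₁ m₂ m₃ : ℕ) (v₁ : V₁) (v₂ : V₂) (v₃ : V₃)
    (hv₁e : e₁ v₁ = 0) (hv₁h : h₁ v₁ = (m₁ : ℂ) • v₁)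
    (hv₂e : e₂ v₂ = 0) (hv₂h : h₂ v₂ = (m₂ : ℂ) • v₂)
    (hv₃e : e₃ v₃ = 0) (hv₃h : h₃ v₃ = (m₃ : ℂ) • v₃)
    (r r₁ : ℕ) (hadm : Admissible m₁ m₂ m₃ r (r₁ : ℤ)) :
    Omega12Triple (V₃ := V₃) e₁ f₁ h₁ e₂ f₂ h₂ (Wvec f₁ f₂ f₃ v₁ v₂ v₃ m₁ m₂ m₃ r r₁) =
      ((r₁ : ℂ) * ((r₁ : ℂ) - (m₁ : ℂ) - (m₂ : ℂ) - 1) + (m₁ : ℂ) * (m₂ : ℂ) / 2) •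
        Wvec f₁ f₂ f₃ v₁ v₂ v₃ m₁ m₂ m₃ r r₁ := by
  have hk₁ : r₁ ≤ m₁ := by have := hadm.2.2.2.1; omega
  have hk₂ : r₁ ≤ m₂ := by have := hadm.2.2.2.2.1; omega
  rw [Wvec_eq_sum_primVec, map_sum, Finset.smul_sum]
  refine Finset.sum_congr rfl fun j _ => ?_
  have hcomm := LinearMap.congr_fun ((commute_omegaTensor_diagAction hsl1 hsl2).pow_right j).eq
    (primVec f₁ f₂ v₁ v₂ m₁ m₂ r₁)
  rw [Module.End.mul_apply, Module.End.mul_apply,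
    omegaTensor_primVec hsl1 hsl2 hv₁e hv₁h hv₂e hv₂h hk₁ hk₂, map_smul, omegaTensor] at hcomm
  rw [map_smul, Omega12Triple, LinearMap.rTensor_tmul, hcomm, ← TensorProduct.smul_tmul',
    smul_comm]
end
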